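/- In the setting: F(u,v) = (u + α_1 v)⋯(u + α_n v) is a separable binary form of degree n with α_1,…,α_n distinct algebraic numbers, K = k(α_1,…,α_n), each infinite place ν of k is extended to K, ε > 0, θ = ε/n, A ∈ (ℝ_{≥1})^{s_k} with components A_ν, 𝒜 is the set of (u,v) ∈ 𝔬² with A_ν ≤ max{∥u∥_ν, ∥v∥_ν} < 2A_ν for all ν | ∞ and F(u,v) ≠ 0, C > 0 is a constant such that ∥u + α_i v∥_ν < C·A_ν for all (u,v) ∈ 𝒜, all i, and all ν | ∞, and 𝒜_ν(i, q) = {(u,v) ∈ 𝒜 : C·A_ν^{1−(q+1)θ} ≤ ∥u + α_i v∥_ν < C·A_ν^{1−qθ}}. Then there exists a constant c(k,F) > 0 such that for any infinite place ν, any indices i_1 ≠ i_2 in {1,…,n}, and any integers q_1, q_2 ≥ 1, if A_ν > c(k,F) then 𝒜_ν(i_1, q_1) ∩ 𝒜_ν(i_2, q_2) = ∅. -/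

import Mathlib

open NumberField

/-- The normalized absolute value `∥x∥_w = |x|_w^{d_w}` at an infinite place `w`. -/
noncomputable def plNorm {k : Type*} [Field k] [NumberField k]
    (w : InfinitePlace k) (x : k) : ℝ := w x ^ w.mult

/-- The natural map `𝓞 k → K` for a `k`-algebra `K`. -/
noncomputable def iotaK {k : Type*} [Field k] [NumberField k]
    (K : Type*) [Field K] [Algebra k K] (u : 𝓞 k) : K :=
  algebraMap k K (u : k)

/-- The normalized absolute value on `K` extending `∥·∥_w`, computed via the fixed
embedding `σ_w : K → ℂ` lying above `w`. -/
noncomputable def KNorm {k : Type*} [Field k] [NumberField k]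
    {K : Type*} [Field K] (σ : InfinitePlace k → (K →+* ℂ))
    (w : InfinitePlace k) (x : K) : ℝ :=
  ‖σ w x‖ ^ w.mult

/-- The set `𝒜`: pairs `(u,v) ∈ 𝔬²` with `A_w ≤ max{∥u∥_w, ∥v∥_w} < 2A_w` for all
`w | ∞` and `F(u,v) = ∏ᵢ (u + αᵢ v) ≠ 0`. -/
noncomputable def setA {k : Type*} [Field k] [NumberField k]
    {K : Type*} [Field K] [Algebra k K] {n : ℕ} (α : Fin n → K)
    (A : InfinitePlace k → ℝ) : Set (𝓞 k × 𝓞 k) :=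
  {p | (∀ w : InfinitePlace k,
          A w ≤ max (plNorm w (p.1 : k)) (plNorm w (p.2 : k)) ∧
          max (plNorm w (p.1 : k)) (plNorm w (p.2 : k)) < 2 * A w) ∧
       (∏ i, (iotaK K p.1 + α i * iotaK K p.2)) ≠ 0}

/-- The set `𝒜_ν(i, q) = {(u,v) ∈ 𝒜 : C·A_ν^{1-(q+1)θ} ≤ ∥u + αᵢ v∥_ν < C·A_ν^{1-qθ}}`. -/
noncomputable def setAnu {k : Type*} [Field k] [NumberField k]
    {K : Type*} [Field K] [Algebra k K] {n : ℕ} (α : Fin n → K)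
    (σ : InfinitePlace k → (K →+* ℂ)) (C θ : ℝ) (A : InfinitePlace k → ℝ)
    (w : InfinitePlace k) (i : Fin n) (q : ℕ) : Set (𝓞 k × 𝓞 k) :=
  {p ∈ setA α A |
    C * A w ^ ((1 : ℝ) - (q + 1) * θ) ≤ KNorm σ w (iotaK K p.1 + α i * iotaK K p.2) ∧
    KNorm σ w (iotaK K p.1 + α i * iotaK K p.2) < C * A w ^ ((1 : ℝ) - q * θ)}

/-- The set `𝒞_ν(i, q) = {(u,v) ∈ 𝒜 : ∥u + αᵢ v∥_ν < C·A_ν^{1-qθ}}`. -/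
noncomputable def setCnu {k : Type*} [Field k] [NumberField k]
    {K : Type*} [Field K] [Algebra k K] {n : ℕ} (α : Fin n → K)
    (σ : InfinitePlace k → (K →+* ℂ)) (C θ : ℝ) (A : InfinitePlace k → ℝ)
    (w : InfinitePlace k) (i : Fin n) (q : ℕ) : Set (𝓞 k × 𝓞 k) :=
  {p ∈ setA α A |
    KNorm σ w (iotaK K p.1 + α i * iotaK K p.2) < C * A w ^ ((1 : ℝ) - q * θ)}

/-- If two linear forms `u + a v` and `u + b v` are both small, then so are `u` and `v`, up to the
difference `a - b`. -/
theorem norm_sub_pow_mul_max_le {a b u v : ℂ} {d : ℕ} {B : ℝ}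
    (h₁ : ‖u + a * v‖ ^ d ≤ B) (h₂ : ‖u + b * v‖ ^ d ≤ B) :
    ‖a - b‖ ^ d * max (‖u‖ ^ d) (‖v‖ ^ d) ≤ (2 + ‖a‖ + ‖b‖) ^ d * B := by
  set m := max ‖u + a * v‖ ‖u + b * v‖ with hm
  have hmB : m ^ d ≤ B := by
    rcases max_choice ‖u + a * v‖ ‖u + b * v‖ with h | h <;> rw [hm, h] <;> assumption
  have hm₁ : ‖u + a * v‖ ≤ m := le_max_left _ _
  have hm₂ : ‖u + b * v‖ ≤ m := le_max_right _ _
  have hm₀ : 0 ≤ m := (norm_nonneg _).trans hm₁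
  have key (x : ℂ) (hx : ‖a - b‖ * ‖x‖ ≤ (2 + ‖a‖ + ‖b‖) * m) :
      ‖a - b‖ ^ d * ‖x‖ ^ d ≤ (2 + ‖a‖ + ‖b‖) ^ d * B :=
    calc ‖a - b‖ ^ d * ‖x‖ ^ d = (‖a - b‖ * ‖x‖) ^ d := (mul_pow _ _ _).symm
      _ ≤ ((2 + ‖a‖ + ‖b‖) * m) ^ d := by gcongr
      _ = (2 + ‖a‖ + ‖b‖) ^ d * m ^ d := mul_pow _ _ _
      _ ≤ (2 + ‖a‖ + ‖b‖) ^ d * B := by gcongr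
  have hu : ‖a - b‖ * ‖u‖ ≤ (2 + ‖a‖ + ‖b‖) * m :=
    calc ‖a - b‖ * ‖u‖ = ‖a * (u + b * v) - b * (u + a * v)‖ := by
          rw [← norm_mul]; congr 1; ring
      _ ≤ ‖a‖ * ‖u + b * v‖ + ‖b‖ * ‖u + a * v‖ := by
          simpa only [norm_mul] using norm_sub_le (a * (u + b * v)) (b * (u + a * v))
      _ ≤ ‖a‖ * m + ‖b‖ * m := by gcongr
      _ ≤ (2 + ‖a‖ + ‖b‖) * m := by linarith
  have hv : ‖a - b‖ * ‖v‖ ≤ (2 + ‖a‖ + ‖b‖) * m :=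
    calc ‖a - b‖ * ‖v‖ = ‖(u + a * v) - (u + b * v)‖ := by
          rw [← norm_mul]; congr 1; ring
      _ ≤ ‖u + a * v‖ + ‖u + b * v‖ := norm_sub_le _ _
      _ ≤ 2 * m := by linarith
      _ ≤ (2 + ‖a‖ + ‖b‖) * m := by gcongr; linarith [norm_nonneg a, norm_nonneg b]
  rcases max_choice (‖u‖ ^ d) (‖v‖ ^ d) with h | h <;> rw [h]
  exacts [key u hu, key v hv]

/-- disjointness of the sets `𝒜_ν(i,q)` for distinct roots:  in the
setting of a separable form `F(u,v) = ∏ᵢ(u + αᵢ v)` with distinct roots `αᵢ ∈ K`,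
embeddings `σ_w` extending the infinite places of `k`, `θ = ε/n`, and a constant `C`
bounding `∥u + αᵢ v∥_w < C·A_w` on `𝒜`, there is a constant `c(k,F) > 0` such that for
every infinite place `w`, indices `i₁ ≠ i₂` and integers `q₁, q₂ ≥ 1`, if `A_w > c(k,F)`
then `𝒜_w(i₁,q₁) ∩ 𝒜_w(i₂,q₂) = ∅`. -/
theorem Anu_disjoint {k : Type*} [Field k] [NumberField k]
    {K : Type*} [Field K] [Algebra k K] [FiniteDimensional k K]
    {n : ℕ} (α : Fin n → K) (hα : Function.Injective α)
    (σ : InfinitePlace k → (K →+* ℂ))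
    (hσ : ∀ (w : InfinitePlace k) (x : k), ‖σ w (algebraMap k K x)‖ = w x)
    (ε : ℝ) (hε : 0 < ε) (C : ℝ) (hC : 0 < C)
    (hCA : ∀ A : InfinitePlace k → ℝ, (∀ w, 1 ≤ A w) →
      ∀ p ∈ setA α A, ∀ (i : Fin n) (w : InfinitePlace k),
        KNorm σ w (iotaK K p.1 + α i * iotaK K p.2) < C * A w) :
    ∃ c : ℝ, 0 < c ∧
      ∀ A : InfinitePlace k → ℝ, (∀ w, 1 ≤ A w) →
      ∀ (w : InfinitePlace k) (i₁ i₂ : Fin n) (q₁ q₂ : ℕ),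
        i₁ ≠ i₂ → 1 ≤ q₁ → 1 ≤ q₂ → c < A w →
        setAnu α σ C (ε / n) A w i₁ q₁ ∩ setAnu α σ C (ε / n) A w i₂ q₂ = ∅ := by
  rcases Nat.eq_zero_or_pos n with rfl | hn
  · exact ⟨1, one_pos, fun _ _ _ i => i.elim0⟩
  have hθ : 0 < ε / n := div_pos hε (Nat.cast_pos.2 hn)
  have hlarge : ∀ᶠ a : ℝ in Filter.atTop, ∀ (w : InfinitePlace k) (i j : Fin n),
      (2 + ‖σ w (α i)‖ + ‖σ w (α j)‖) ^ w.mult * C / ‖σ w (α i) - σ w (α j)‖ ^ w.mult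
        < a ^ (ε / n) := by
    simp only [Filter.eventually_all]
    exact fun _ _ _ => (tendsto_rpow_atTop hθ).eventually_gt_atTop _
  obtain ⟨c, hc⟩ := Filter.eventually_atTop.1 hlarge
  refine ⟨max c 1, by positivity, fun A hA w i j q₁ q₂ hij hq₁ hq₂ hcA => ?_⟩
  rw [Set.eq_empty_iff_forall_notMem]
  rintro p ⟨⟨hp, -, h₁⟩, ⟨-, -, h₂⟩⟩
  have hA₀ : 0 < A w := one_pos.trans_le (hA w)
  have hexp (q : ℕ) (hq : 1 ≤ q) :
      C * A w ^ ((1 : ℝ) - q * (ε / n)) ≤ C * A w ^ ((1 : ℝ) - ε / n) := by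
    have : (1 : ℝ) ≤ q := by exact_mod_cast hq
    gcongr
    · exact hA w
    · nlinarith
  have hιp (x : 𝓞 k) : ‖σ w (iotaK K x)‖ ^ w.mult = plNorm w (x : k) := by
    rw [iotaK, hσ, plNorm]
  simp only [KNorm, map_add, map_mul] at h₁ h₂
  have hbound := norm_sub_pow_mul_max_le (h₁.le.trans (hexp q₁ hq₁)) (h₂.le.trans (hexp q₂ hq₂))
  rw [hιp, hιp] at hbound
  have hδ : 0 < ‖σ w (α i) - σ w (α j)‖ ^ w.mult :=
    pow_pos (norm_pos_iff.2 (sub_ne_zero.2 fun h => hij (hα ((σ w).injective h)))) _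
  have hT := hc (A w) ((le_max_left c 1).trans hcA.le) w i j
  rw [div_lt_iff₀ hδ] at hT
  have hlower := (mul_le_mul_of_nonneg_left (hp.1 w).1 hδ.le).trans hbound
  have hpow : 0 < A w ^ ((1 : ℝ) - ε / n) := Real.rpow_pos_of_pos hA₀ _
  have hsplit : A w ^ (ε / n) * A w ^ ((1 : ℝ) - ε / n) = A w := by
    rw [← Real.rpow_add hA₀, add_sub_cancel, Real.rpow_one]
  have hupper := mul_lt_mul_of_pos_right hT hpow
  rw [mul_right_comm, mul_right_comm (A w ^ (ε / n)), hsplit] at hupper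
  linarith
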